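/- arXiv:1802.00770 — 3 statements merged into one kernel-verified Lean document; each statement's English description precedes it below -/
import Mathlib

section
/- Fix i ∈ {0,1,2}. For every nonzero x = (x₀,x₁,x₂) ∈ ℂ³, define y = (y₀,y₁,y₂) ∈ ℂ³ by y_j = conj(x_j) for j ≠ i and y_i = −conj(x_i). Then the two equations x₀y₀ − x₁y₁ + i·x₂y₂ = 0 and x₀y₀ + x₁y₁ + x₂y₂ = 0 (where i denotes the imaginary unit) cannot both hold. Consequently each sphere S_i is disjoint from the divisor D. -/
/-- The only real solution of `a - b + i·c = 0`, `a + b + c = 0` is zero. -/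
lemma real_eq_zero_of_pencil {a b c : ℝ}
    (h₁ : (a : ℂ) - b + Complex.I * c = 0) (h₂ : (a : ℂ) + b + c = 0) :
    a = 0 ∧ b = 0 ∧ c = 0 := by
  have hre : a - b = 0 := by simpa using congrArg Complex.re h₁
  have him : c = 0 := by simpa using congrArg Complex.im h₁
  have hsum : a + b + c = 0 := by exact_mod_cast h₂
  refine ⟨?_, ?_, him⟩ <;> linarith

/-- Fix `i ∈ {0,1,2}`. For every nonzero `x ∈ ℂ³`, with `y` the conjugate of `x`
with the sign of the `i`-th coordinate flipped, the equations `x₀y₀ − x₁y₁ + i·x₂y₂ = 0` and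
`x₀y₀ + x₁y₁ + x₂y₂ = 0` cannot both hold; hence each sphere `S_i` is disjoint from the
divisor `D`. -/
theorem stmt_2 (i : Fin 3) (x : Fin 3 → ℂ) (hx : x ≠ 0)
    (y : Fin 3 → ℂ)
    (hy : ∀ j : Fin 3, y j = if j = i then -(starRingEnd ℂ) (x j) else (starRingEnd ℂ) (x j)) :
    ¬ (x 0 * y 0 - x 1 * y 1 + Complex.I * (x 2 * y 2) = 0 ∧
        x 0 * y 0 + x 1 * y 1 + x 2 * y 2 = 0) := by
  rintro ⟨h₁, h₂⟩
  have hxy : ∀ j, x j * y j =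
      ((if j = i then -Complex.normSq (x j) else Complex.normSq (x j) : ℝ) : ℂ) := by
    intro j
    rw [hy j]
    split_ifs <;> simp [Complex.mul_conj]
  rw [hxy 0, hxy 1, hxy 2] at h₁ h₂
  obtain ⟨h0, h1, h2⟩ := real_eq_zero_of_pencil h₁ h₂
  have hzero : ∀ j, (if j = i then -Complex.normSq (x j) else Complex.normSq (x j)) = 0 :=
    Fin.forall_fin_succ.2 ⟨h0, Fin.forall_fin_two.2 ⟨h1, h2⟩⟩
  refine hx (funext fun j => Complex.normSq_eq_zero.1 ?_)
  have hj := hzero j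
  split_ifs at hj <;> linarith
end

section
/- Let x ∈ ℂ³ be nonzero with at least two of its coordinates x₀, x₁, x₂ nonzero. Then the subset {[y] ∈ ℙ(ℂ³) : x₀y₀ + x₁y₁ + x₂y₂ = 0 and x₀y₀ − x₁y₁ + i·x₂y₂ ≠ 0} of the complex projective plane is homeomorphic to ℂ. -/
open scoped LinearAlgebra.Projectivization

noncomputable instance projTop (K V : Type*) [DivisionRing K] [AddCommGroup V] [Module K V]
    [TopologicalSpace V] : TopologicalSpace (ℙ K V) :=
  inferInstanceAs (TopologicalSpace (Quotient (projectivizationSetoid K V)))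

namespace Projectivization

theorem isQuotientMap_mk (K V : Type*) [DivisionRing K] [AddCommGroup V] [Module K V]
    [TopologicalSpace V] :
    Topology.IsQuotientMap fun v : {v : V // v ≠ 0} => mk K v.1 v.2 :=
  isQuotientMap_quot_mk

section Chart

variable {K V : Type*} [Field K] [AddCommGroup V] [Module K V]

/-- A representative of `[v]` has the same vanishing linear functionals as `v`. -/
theorem map_rep_mk_eq_zero_iff (f : V →ₗ[K] K) {v : V} (hv : v ≠ 0) :
    f (mk K v hv).rep = 0 ↔ f v = 0 := by
  obtain ⟨a, ha⟩ := exists_smul_eq_mk_rep K v hv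
  rw [← ha, Units.smul_def, map_smul, smul_eq_mul, mul_eq_zero, or_iff_right a.ne_zero]

/-- A ratio of linear functionals does not depend on the representative. -/
theorem map_rep_mk_div_map_rep_mk (f g : V →ₗ[K] K) {v : V} (hv : v ≠ 0) :
    f (mk K v hv).rep / g (mk K v hv).rep = f v / g v := by
  obtain ⟨a, ha⟩ := exists_smul_eq_mk_rep K v hv
  rw [← ha, Units.smul_def, map_smul, map_smul, smul_eq_mul, smul_eq_mul,
    mul_div_mul_left _ _ a.ne_zero]

variable [TopologicalSpace K] [T1Space K] [TopologicalSpace V]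

theorem isOpen_setOf_map_rep_ne_zero (g : V →L[K] K) : IsOpen {p : ℙ K V | g p.rep ≠ 0} := by
  rw [← (isQuotientMap_mk K V).isOpen_preimage]
  have h : IsOpen {v : {v : V // v ≠ 0} | g v.1 ≠ 0} :=
    isOpen_ne.preimage (g.continuous.comp continuous_subtype_val)
  convert h using 1
  ext v
  exact (map_rep_mk_eq_zero_iff (g : V →ₗ[K] K) v.2).not

variable [ContinuousMul K] [ContinuousInv₀ K]

theorem continuousOn_map_rep_div_map_rep (f g : V →L[K] K) :
    ContinuousOn (fun p : ℙ K V => f p.rep / g p.rep) {p | g p.rep ≠ 0} := by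
  rw [(isQuotientMap_mk K V).continuousOn_isOpen_iff
    (isOpen_setOf_map_rep_ne_zero g)]
  have h : ContinuousOn (fun v : {v : V // v ≠ 0} => f v.1 / g v.1) {v | g v.1 ≠ 0} :=
    (f.continuous.comp continuous_subtype_val).continuousOn.div
      (g.continuous.comp continuous_subtype_val).continuousOn fun _ hv => hv
  refine (h.congr fun v _ => ?_).mono fun v hv => ?_
  · exact map_rep_mk_div_map_rep_mk (f : V →ₗ[K] K) (g : V →ₗ[K] K) v.2
  · exact (map_rep_mk_eq_zero_iff (g : V →ₗ[K] K) v.2).not.mp hv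

/-- In linear coordinates on a three-dimensional space, the projective line where the first
coordinate vanishes, minus the point where the second one vanishes too, is an affine line. -/
noncomputable def puncturedLineHomeomorph (L : V ≃L[K] (Fin 3 → K)) :
    {p : ℙ K V | L p.rep 0 = 0 ∧ L p.rep 1 ≠ 0} ≃ₜ K :=
  let coord (i : Fin 3) : V →L[K] K := (ContinuousLinearMap.proj i).comp (L : V →L[K] (Fin 3 → K))
  have hne (t : K) : L.symm ![0, 1, t] ≠ 0 := fun h => by
    simpa using congrFun (L.symm.map_eq_zero_iff.mp h) 1
  { toFun p := L p.1.rep 2 / L p.1.rep 1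
    invFun t := ⟨mk K (L.symm ![0, 1, t]) (hne t),
      (map_rep_mk_eq_zero_iff (coord 0 : V →ₗ[K] K) (hne t)).mpr (by simp [coord]),
      (map_rep_mk_eq_zero_iff (coord 1 : V →ₗ[K] K) (hne t)).not.mpr (by simp [coord])⟩
    left_inv := by
      rintro ⟨p, h0, h1⟩
      refine Subtype.ext (((mk_eq_mk_iff' K _ _ _ p.rep_nonzero).mpr
        ⟨(L p.rep 1)⁻¹, L.injective ?_⟩).trans p.mk_rep)
      rw [map_smul, L.apply_symm_apply]
      ext i
      fin_cases i
      · simp [h0]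
      · simp [h1]
      · simp [div_eq_inv_mul]
    right_inv t := by
      refine (map_rep_mk_div_map_rep_mk (coord 2 : V →ₗ[K] K) (coord 1 : V →ₗ[K] K)
        (hne t)).trans ?_
      simp [coord]
    continuous_toFun :=
      (continuousOn_map_rep_div_map_rep (coord 2) (coord 1)).comp_continuous
        continuous_subtype_val fun p => p.2.2
    continuous_invFun := by
      refine Continuous.subtype_mk ((isQuotientMap_mk K V).continuous.comp
        (Continuous.subtype_mk (L.symm.continuous.comp ?_) hne)) _
      refine continuous_pi fun i => ?_
      fin_cases i
      · exact continuous_const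
      · exact continuous_const
      · exact continuous_id }

end Chart

end Projectivization

/-- The functionals `(x₀, x₁, x₂)` and `(x₀, -x₁, i x₂)` are completed to a basis of the dual of
`ℂ³` by the coordinate complementary to two nonzero coordinates of `x`. -/
theorem exists_det_ne_zero_of_two_le_ncard (x : Fin 3 → ℂ)
    (h2 : 2 ≤ {j : Fin 3 | x j ≠ 0}.ncard) :
    ∃ c : Fin 3 → ℂ,
      (Matrix.of ![![x 0, x 1, x 2], ![x 0, -x 1, Complex.I * x 2], c]).det ≠ 0 := by
  have hI₁ : Complex.I + 1 ≠ 0 := fun h => by simpa using congrArg Complex.im h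
  have hI₂ : Complex.I - 1 ≠ 0 := fun h => by simpa using congrArg Complex.im h
  obtain ⟨a, ha, b, hb, hab⟩ := (Set.one_lt_ncard (Set.toFinite _)).mp h2
  have h : (x 1 ≠ 0 ∧ x 2 ≠ 0) ∨ (x 0 ≠ 0 ∧ x 2 ≠ 0) ∨ (x 0 ≠ 0 ∧ x 1 ≠ 0) := by
    fin_cases a <;> fin_cases b <;> simp_all
  rcases h with ⟨h, h'⟩ | ⟨h, h'⟩ | ⟨h, h'⟩
  · refine ⟨![1, 0, 0], ?_⟩
    have := mul_ne_zero (mul_ne_zero h h') hI₁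
    simp only [Matrix.det_fin_three]
    simp
    grind
  · refine ⟨![0, 1, 0], ?_⟩
    have := mul_ne_zero (mul_ne_zero h h') hI₂
    simp only [Matrix.det_fin_three]
    simp
    grind
  · refine ⟨![0, 0, 1], ?_⟩
    have := mul_ne_zero h h'
    simp only [Matrix.det_fin_three]
    simp
    grind

/-- For nonzero `x ∈ ℂ³` with at least two nonzero coordinates, the subset
`{[y] ∈ ℙ(ℂ³) : x₀y₀ + x₁y₁ + x₂y₂ = 0 and x₀y₀ − x₁y₁ + i·x₂y₂ ≠ 0}` is homeomorphic to `ℂ`. -/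
theorem stmt_13 (x : Fin 3 → ℂ) (hx : x ≠ 0) (h2 : 2 ≤ {j : Fin 3 | x j ≠ 0}.ncard) :
    Nonempty
      (({p : ℙ ℂ (Fin 3 → ℂ) |
            x 0 * p.rep 0 + x 1 * p.rep 1 + x 2 * p.rep 2 = 0 ∧
            x 0 * p.rep 0 - x 1 * p.rep 1 + Complex.I * (x 2 * p.rep 2) ≠ 0} :
          Set (ℙ ℂ (Fin 3 → ℂ))) ≃ₜ ℂ) := by
  obtain ⟨c, hc⟩ := exists_det_ne_zero_of_two_le_ncard x h2
  set M := Matrix.of ![![x 0, x 1, x 2], ![x 0, -x 1, Complex.I * x 2], c]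
  let L : (Fin 3 → ℂ) ≃L[ℂ] (Fin 3 → ℂ) :=
    (Matrix.toLinearEquiv' M (M.invertibleOfIsUnitDet hc.isUnit)).toContinuousLinearEquiv
  have hL (y : Fin 3 → ℂ) : L y = M.mulVec y := rfl
  refine ⟨(Homeomorph.setCongr ?_).trans (Projectivization.puncturedLineHomeomorph L)⟩
  ext p
  simp [hL, M, Matrix.mulVec, dotProduct, Fin.sum_univ_three, sub_eq_add_neg, mul_assoc]
end

section
/- The space X \ D = {([x],[y]) ∈ ℙ(ℂ³) × ℙ(ℂ³) : x₀y₀ + x₁y₁ + x₂y₂ = 0 and x₀y₀ − x₁y₁ + i·x₂y₂ ≠ 0} is homotopy equivalent to the complement of the three coordinate points in the complex projective plane, ℙ(ℂ³) \ {[1:0:0], [0:1:0], [0:0:1]}. -/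
open scoped LinearAlgebra.Projectivization

/-- The `i`-th coordinate point of `ℙ(ℂ³)`, i.e. `[1:0:0]`, `[0:1:0]`, `[0:0:1]`. -/
noncomputable def coordPoint (i : Fin 3) : ℙ ℂ (Fin 3 → ℂ) :=
  Projectivization.mk ℂ (Pi.single i 1)
    (by
      intro h
      have := congrFun h i
      simp [Pi.single_eq_same] at this)

open Projectivization

section Topology

variable {K V : Type*} [DivisionRing K] [AddCommGroup V] [Module K V] [TopologicalSpace V]

theorem continuous_projectivization_mk' : Continuous (mk' K : {v : V // v ≠ 0} → ℙ K V) :=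
  continuous_quotient_mk'

theorem continuous_projectivization_mk {Z : Type*} [TopologicalSpace Z] {f : Z → V}
    (hf : Continuous f) (h0 : ∀ z, f z ≠ 0) : Continuous fun z => mk K (f z) (h0 z) :=
  continuous_projectivization_mk'.comp (hf.subtype_mk h0)

theorem isOpenQuotientMap_projectivization_mk' [ContinuousConstSMul K V] :
    IsOpenQuotientMap (mk' K : {v : V // v ≠ 0} → ℙ K V) := by
  refine ⟨Quotient.mk_surjective, continuous_projectivization_mk', fun U hU => ?_⟩
  change IsOpen (mk' K ⁻¹' (mk' K '' U))
  have scaled_ne (a : Kˣ) (v : {v : V // v ≠ 0}) : a • (v : V) ≠ 0 := by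
    simpa [Units.smul_def] using v.2
  have preimage_eq : mk' K ⁻¹' (mk' K '' U) =
      ⋃ a : Kˣ, (fun v : {v : V // v ≠ 0} =>
        (⟨a • (v : V), scaled_ne a v⟩ : {v : V // v ≠ 0})) ⁻¹' U := by
    ext v
    simp only [Set.mem_preimage, Set.mem_image, Set.mem_iUnion]
    constructor
    · rintro ⟨w, hw, hwv⟩
      obtain ⟨a, ha⟩ := (mk_eq_mk_iff K _ _ w.2 v.2).1 hwv
      exact ⟨a, by simpa only [ha] using hw⟩
    · rintro ⟨a, ha⟩
      exact ⟨_, ha, (mk_eq_mk_iff K _ _ (scaled_ne a v) v.2).2 ⟨a, rfl⟩⟩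
  rw [preimage_eq]
  refine isOpen_iUnion fun a => hU.preimage ?_
  exact (continuous_subtype_val.const_smul (a : K)).subtype_mk _

end Topology

/-- The bilinear form cutting out the flag variety. -/
noncomputable def flagForm (x y : Fin 3 → ℂ) : ℂ :=
  x 0 * y 0 + x 1 * y 1 + x 2 * y 2

/-- The bilinear form cutting out the divisor. -/
noncomputable def divisorForm (x y : Fin 3 → ℂ) : ℂ :=
  x 0 * y 0 - x 1 * y 1 + Complex.I * (x 2 * y 2)

/-- Up to the factor `‖x‖²`, the orthogonal projection of the complex conjugate of
`(x₀, -x₁, i x₂)` to the kernel of `flagForm x`. -/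
noncomputable def fiberSection (x : Fin 3 → ℂ) : Fin 3 → ℂ :=
  let n := x 0 * star (x 0) + x 1 * star (x 1) + x 2 * star (x 2)
  let m := x 0 * star (x 0) - x 1 * star (x 1) - Complex.I * (x 2 * star (x 2))
  ![(n - m) * star (x 0), (-n - m) * star (x 1), (-Complex.I * n - m) * star (x 2)]

/-- The segment from `fiberSection x` to `y`, with both ends scaled to the same value of
`divisorForm x`. -/
noncomputable def fiberSegment (t : ℝ) (x y : Fin 3 → ℂ) : Fin 3 → ℂ :=
  ((t : ℂ) * divisorForm x (fiberSection x)) • y +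
    ((1 - t : ℂ) * divisorForm x y) • fiberSection x

theorem flagForm_smul (a b : ℂ) (x y : Fin 3 → ℂ) :
    flagForm (a • x) (b • y) = a * b * flagForm x y := by
  simp only [flagForm, Pi.smul_apply, smul_eq_mul]; ring

theorem divisorForm_smul (a b : ℂ) (x y : Fin 3 → ℂ) :
    divisorForm (a • x) (b • y) = a * b * divisorForm x y := by
  simp only [divisorForm, Pi.smul_apply, smul_eq_mul]; ring

theorem fiberSection_smul (a : ℂ) (x : Fin 3 → ℂ) :
    fiberSection (a • x) = (a * star a * star a) • fiberSection x := by
  ext i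
  fin_cases i <;> simp [fiberSection] <;> ring

theorem flagForm_fiberSection (x : Fin 3 → ℂ) : flagForm x (fiberSection x) = 0 := by
  simp [flagForm, fiberSection]; ring

theorem divisorForm_fiberSection (x : Fin 3 → ℂ) :
    divisorForm x (fiberSection x) =
      ((4 * (Complex.normSq (x 0) * Complex.normSq (x 1)) +
        2 * (Complex.normSq (x 0) * Complex.normSq (x 2)) +
        2 * (Complex.normSq (x 1) * Complex.normSq (x 2)) : ℝ) : ℂ) := by
  push_cast
  simp only [Complex.normSq_eq_conj_mul_self, divisorForm, fiberSection, Complex.star_def]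
  simp
  linear_combination
    (-(x 2 * starRingEnd ℂ (x 2) * (x 0 * starRingEnd ℂ (x 0) + x 1 * starRingEnd ℂ (x 1)))) *
      Complex.I_sq

theorem divisorForm_zero_right (x : Fin 3 → ℂ) : divisorForm x 0 = 0 := by
  simp [divisorForm]

theorem ne_zero_of_divisorForm_ne_zero {x y : Fin 3 → ℂ} (h : divisorForm x y ≠ 0) : y ≠ 0 := by
  rintro rfl
  exact h (divisorForm_zero_right x)

theorem flagForm_fiberSegment {x y : Fin 3 → ℂ} (h : flagForm x y = 0) (t : ℝ) :
    flagForm x (fiberSegment t x y) = 0 := by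
  have hs := flagForm_fiberSection x
  simp only [flagForm, fiberSegment, Pi.add_apply, Pi.smul_apply, smul_eq_mul] at *
  linear_combination (t * divisorForm x (fiberSection x)) * h + ((1 - t) * divisorForm x y) * hs

theorem divisorForm_fiberSegment (x y : Fin 3 → ℂ) (t : ℝ) :
    divisorForm x (fiberSegment t x y) = divisorForm x (fiberSection x) * divisorForm x y := by
  simp only [fiberSegment]
  generalize fiberSection x = s
  simp only [divisorForm, Pi.add_apply, Pi.smul_apply, smul_eq_mul]
  ring

theorem fiberSegment_smul (t : ℝ) (a b : ℂ) (x y : Fin 3 → ℂ) :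
    fiberSegment t (a • x) (b • y) =
      (a * a * star a * star a * b) • fiberSegment t x y := by
  rw [fiberSegment, fiberSection_smul, divisorForm_smul, divisorForm_smul, fiberSegment]
  ext i
  simp only [Pi.add_apply, Pi.smul_apply, smul_eq_mul]
  ring

theorem continuous_divisorForm :
    Continuous fun q : (Fin 3 → ℂ) × (Fin 3 → ℂ) => divisorForm q.1 q.2 := by
  unfold divisorForm
  fun_prop

theorem continuous_fiberSection : Continuous fiberSection := by
  refine continuous_pi fun i => ?_
  fin_cases i <;> simp [fiberSection] <;> fun_prop

theorem continuous_fiberSegment :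
    Continuous fun q : ℝ × (Fin 3 → ℂ) × (Fin 3 → ℂ) => fiberSegment q.1 q.2.1 q.2.2 := by
  have hs := continuous_fiberSection
  have hd : Continuous fun q : ℝ × (Fin 3 → ℂ) × (Fin 3 → ℂ) =>
      divisorForm q.2.1 (fiberSection q.2.1) := continuous_divisorForm.comp
    (by fun_prop : Continuous fun q : ℝ × (Fin 3 → ℂ) × (Fin 3 → ℂ) =>
      (q.2.1, fiberSection q.2.1))
  have hy : Continuous fun q : ℝ × (Fin 3 → ℂ) × (Fin 3 → ℂ) => divisorForm q.2.1 q.2.2 :=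
    continuous_divisorForm.comp continuous_snd
  unfold fiberSegment
  fun_prop

/-- The complement of the divisor in the flag variety. -/
def flagComplement : Set (ℙ ℂ (Fin 3 → ℂ) × ℙ ℂ (Fin 3 → ℂ)) :=
  {q | flagForm q.1.rep q.2.rep = 0 ∧ divisorForm q.1.rep q.2.rep ≠ 0}

/-- The complement of the coordinate points in the projective plane. -/
def coordComplement : Set (ℙ ℂ (Fin 3 → ℂ)) :=
  {p | p ∉ ({coordPoint 0, coordPoint 1, coordPoint 2} : Set (ℙ ℂ (Fin 3 → ℂ)))}

theorem mk_mem_flagComplement_iff {x y : Fin 3 → ℂ} (hx : x ≠ 0) (hy : y ≠ 0) :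
    (mk ℂ x hx, mk ℂ y hy) ∈ flagComplement ↔ flagForm x y = 0 ∧ divisorForm x y ≠ 0 := by
  obtain ⟨a, ha⟩ := exists_smul_eq_mk_rep ℂ x hx
  obtain ⟨b, hb⟩ := exists_smul_eq_mk_rep ℂ y hy
  simp [flagComplement, ← ha, ← hb, Units.smul_def, flagForm_smul, divisorForm_smul]

theorem eq_coordPoint_iff {p : ℙ ℂ (Fin 3 → ℂ)} {i : Fin 3} :
    p = coordPoint i ↔ ∀ j, j ≠ i → p.rep j = 0 := by
  conv_lhs => rw [← mk_rep p, coordPoint, mk_eq_mk_iff']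
  constructor
  · rintro ⟨a, ha⟩ j hj
    simp [← ha, hj]
  · intro h
    refine ⟨p.rep i, ?_⟩
    ext j
    by_cases hj : j = i
    · subst hj; simp
    · simp [hj, h j hj]

theorem divisorForm_fiberSection_ne_zero {p : ℙ ℂ (Fin 3 → ℂ)} (hp : p ∈ coordComplement) :
    divisorForm p.rep (fiberSection p.rep) ≠ 0 := by
  intro h
  rw [divisorForm_fiberSection, Complex.ofReal_eq_zero] at h
  have h01 := mul_nonneg (Complex.normSq_nonneg (p.rep 0)) (Complex.normSq_nonneg (p.rep 1))
  have h02 := mul_nonneg (Complex.normSq_nonneg (p.rep 0)) (Complex.normSq_nonneg (p.rep 2))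
  have h12 := mul_nonneg (Complex.normSq_nonneg (p.rep 1)) (Complex.normSq_nonneg (p.rep 2))
  have e01 : p.rep 0 = 0 ∨ p.rep 1 = 0 := by
    simpa using show Complex.normSq (p.rep 0) * Complex.normSq (p.rep 1) = 0 by linarith
  have e02 : p.rep 0 = 0 ∨ p.rep 2 = 0 := by
    simpa using show Complex.normSq (p.rep 0) * Complex.normSq (p.rep 2) = 0 by linarith
  have e12 : p.rep 1 = 0 ∨ p.rep 2 = 0 := by
    simpa using show Complex.normSq (p.rep 1) * Complex.normSq (p.rep 2) = 0 by linarith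
  apply hp
  simp only [Set.mem_insert_iff, Set.mem_singleton_iff, eq_coordPoint_iff, Fin.forall_fin_succ]
  simp
  tauto

theorem fst_mem_coordComplement {q : ℙ ℂ (Fin 3 → ℂ) × ℙ ℂ (Fin 3 → ℂ)}
    (hq : q ∈ flagComplement) : q.1 ∈ coordComplement := by
  obtain ⟨hflag, hdiv⟩ := hq
  intro hp
  apply hdiv
  simp only [flagForm, divisorForm] at *
  simp only [Set.mem_insert_iff, Set.mem_singleton_iff, eq_coordPoint_iff] at hp
  rcases hp with hp | hp | hp
  · simp_all [hp 1, hp 2]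
  · simp_all [hp 0, hp 2]
  · simp_all [hp 0, hp 1]

theorem fiberSegment_ne_zero (t : ℝ) {q : ℙ ℂ (Fin 3 → ℂ) × ℙ ℂ (Fin 3 → ℂ)}
    (hq : q ∈ flagComplement) : divisorForm q.1.rep (fiberSegment t q.1.rep q.2.rep) ≠ 0 := by
  rw [divisorForm_fiberSegment]
  exact mul_ne_zero (divisorForm_fiberSection_ne_zero (fst_mem_coordComplement hq)) hq.2

/-- The projection of the complement of the divisor to the first factor. -/
def flagProjection : C(flagComplement, coordComplement) where
  toFun q := ⟨q.1.1, fst_mem_coordComplement q.2⟩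
  continuous_toFun := by fun_prop

/-- The section of `flagProjection` given by `fiberSection`. -/
noncomputable def flagSection : C(coordComplement, flagComplement) where
  toFun p := ⟨(p.1, mk ℂ (fiberSection p.1.rep)
      (ne_zero_of_divisorForm_ne_zero (divisorForm_fiberSection_ne_zero p.2))), by
    conv in (p : ℙ ℂ (Fin 3 → ℂ)) => rw [← mk_rep (p : ℙ ℂ (Fin 3 → ℂ))]
    exact (mk_mem_flagComplement_iff _ _).2
      ⟨flagForm_fiberSection _, divisorForm_fiberSection_ne_zero p.2⟩⟩
  continuous_toFun := by
    refine Continuous.subtype_mk (continuous_subtype_val.prodMk ?_) _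
    rw [(isOpenQuotientMap_projectivization_mk'.restrictPreimage
      coordComplement).isQuotientMap.continuous_iff]
    have section_eq (x : mk' ℂ ⁻¹' coordComplement) : ∃ a : ℂˣ,
        a • fiberSection x.1.1 = fiberSection (mk' ℂ x.1).rep := by
      obtain ⟨a, ha⟩ := exists_smul_eq_mk_rep ℂ x.1.1 x.1.2
      refine ⟨a * star a * star a, ?_⟩
      rw [mk'_eq_mk, ← ha, Units.smul_def, Units.smul_def, fiberSection_smul]
      simp
    have section_ne (x : mk' ℂ ⁻¹' coordComplement) : fiberSection x.1.1 ≠ 0 := by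
      obtain ⟨a, ha⟩ := section_eq x
      intro h
      rw [h, smul_zero] at ha
      exact ne_zero_of_divisorForm_ne_zero (divisorForm_fiberSection_ne_zero x.2) ha.symm
    refine (continuous_projectivization_mk (K := ℂ) (continuous_fiberSection.comp
      (continuous_subtype_val.comp continuous_subtype_val)) section_ne).congr fun x => ?_
    exact ((mk_eq_mk_iff ℂ _ _ _ (section_ne x)).2 (section_eq x)).symm

/-- The fiberwise contraction of the complement of the divisor to the image of `flagSection`. -/
noncomputable def flagContraction :
    (flagSection.comp flagProjection).Homotopy (ContinuousMap.id flagComplement) where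
  toFun r := ⟨(r.2.1.1, mk ℂ (fiberSegment r.1 r.2.1.1.rep r.2.1.2.rep)
      (ne_zero_of_divisorForm_ne_zero (fiberSegment_ne_zero r.1 r.2.2))), by
    conv in (r.2 : ℙ ℂ (Fin 3 → ℂ) × ℙ ℂ (Fin 3 → ℂ)).1 =>
      rw [← mk_rep (r.2 : ℙ ℂ (Fin 3 → ℂ) × ℙ ℂ (Fin 3 → ℂ)).1]
    exact (mk_mem_flagComplement_iff _ _).2
      ⟨flagForm_fiberSegment r.2.2.1 _, fiberSegment_ne_zero r.1 r.2.2⟩⟩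
  continuous_toFun := by
    refine Continuous.subtype_mk (Continuous.prodMk (by fun_prop) ?_) _
    have quotient_map := IsOpenQuotientMap.id (X := unitInterval) |>.prodMap
      ((isOpenQuotientMap_projectivization_mk' (K := ℂ) (V := Fin 3 → ℂ)).prodMap
        (isOpenQuotientMap_projectivization_mk' (K := ℂ) (V := Fin 3 → ℂ))
        |>.restrictPreimage flagComplement)
    rw [quotient_map.isQuotientMap.continuous_iff]
    have segment_eq (r : unitInterval × (Prod.map (mk' ℂ) (mk' ℂ) ⁻¹' flagComplement)) :
        ∃ a : ℂˣ, a • fiberSegment r.1 r.2.1.1 r.2.1.2 =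
          fiberSegment r.1 (mk' ℂ r.2.1.1).rep (mk' ℂ r.2.1.2).rep := by
      obtain ⟨a, ha⟩ := exists_smul_eq_mk_rep ℂ r.2.1.1.1 r.2.1.1.2
      obtain ⟨b, hb⟩ := exists_smul_eq_mk_rep ℂ r.2.1.2.1 r.2.1.2.2
      refine ⟨a * a * star a * star a * b, ?_⟩
      rw [mk'_eq_mk, mk'_eq_mk, ← ha, ← hb, Units.smul_def, Units.smul_def, Units.smul_def,
        fiberSegment_smul]
      simp
    have segment_ne (r : unitInterval × (Prod.map (mk' ℂ) (mk' ℂ) ⁻¹' flagComplement)) :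
        fiberSegment r.1 r.2.1.1 r.2.1.2 ≠ 0 := by
      obtain ⟨a, ha⟩ := segment_eq r
      intro h
      rw [h, smul_zero] at ha
      exact ne_zero_of_divisorForm_ne_zero (fiberSegment_ne_zero r.1 r.2.2) ha.symm
    refine (continuous_projectivization_mk (K := ℂ) (continuous_fiberSegment.comp
      (by fun_prop : Continuous fun r : unitInterval ×
        (Prod.map (mk' ℂ) (mk' ℂ) ⁻¹' flagComplement) =>
          ((r.1 : ℝ), (r.2.1.1 : Fin 3 → ℂ), (r.2.1.2 : Fin 3 → ℂ)))) segment_ne).congr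
      fun r => ?_
    exact ((mk_eq_mk_iff ℂ _ _ _ (segment_ne r)).2 (segment_eq r)).symm
  map_zero_left q := by
    refine Subtype.ext (Prod.ext rfl ?_)
    refine (mk_eq_mk_iff' ℂ _ _ _ _).2 ⟨divisorForm q.1.1.rep q.1.2.rep, ?_⟩
    simp [fiberSegment, flagProjection]
  map_one_left q := by
    refine Subtype.ext (Prod.ext rfl ?_)
    refine Eq.trans ?_ (mk_rep q.1.2)
    refine (mk_eq_mk_iff' ℂ _ _ _ _).2 ⟨divisorForm q.1.1.rep (fiberSection q.1.1.rep), ?_⟩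
    simp [fiberSegment]

/-- The complement `X \ D`, realized as
`{([x],[y]) : x₀y₀ + x₁y₁ + x₂y₂ = 0 and x₀y₀ − x₁y₁ + i·x₂y₂ ≠ 0}` in `ℙ(ℂ³) × ℙ(ℂ³)`, is
homotopy equivalent to the complement of the three coordinate points in the complex projective
plane `ℙ(ℂ³)`. -/
theorem stmt_14 :
    Nonempty
      (ContinuousMap.HomotopyEquiv
        ({q : ℙ ℂ (Fin 3 → ℂ) × ℙ ℂ (Fin 3 → ℂ) |
            q.1.rep 0 * q.2.rep 0 + q.1.rep 1 * q.2.rep 1 + q.1.rep 2 * q.2.rep 2 = 0 ∧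
            q.1.rep 0 * q.2.rep 0 - q.1.rep 1 * q.2.rep 1 +
              Complex.I * (q.1.rep 2 * q.2.rep 2) ≠ 0} :
          Set (ℙ ℂ (Fin 3 → ℂ) × ℙ ℂ (Fin 3 → ℂ)))
        ({p : ℙ ℂ (Fin 3 → ℂ) |
            p ∉ ({coordPoint 0, coordPoint 1, coordPoint 2} : Set (ℙ ℂ (Fin 3 → ℂ)))} :
          Set (ℙ ℂ (Fin 3 → ℂ)))) := by
  exact ⟨⟨flagProjection, flagSection, ⟨flagContraction⟩, .refl _⟩⟩
end
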